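/- For all natural numbers m and n, the logic NRAmn enjoys the Lyndon interpolation property (LIP): whenever NRAmn ⊢ φ → ψ, there exists a modal formula χ such that V^•(χ) ⊆ V^•(φ) ∩ V^•(ψ) for each • ∈ {+,−}, NRAmn ⊢ φ → χ, and NRAmn ⊢ χ → ψ. -/

import Mathlib

/-- Propositional formulas. -/
inductive PropForm : Type
  | var : ℕ → PropForm
  | fls : PropForm
  | and : PropForm → PropForm → PropForm
  | or : PropForm → PropForm → PropForm
  | imp : PropForm → PropForm → PropForm
  deriving DecidableEq

/-- Boolean evaluation of a propositional formula. -/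
def PropForm.eval (v : ℕ → Bool) : PropForm → Bool
  | .var i => v i
  | .fls => false
  | .and φ ψ => φ.eval v && ψ.eval v
  | .or φ ψ => φ.eval v || ψ.eval v
  | .imp φ ψ => !φ.eval v || ψ.eval v

/-- Classical propositional tautology. -/
def PropForm.Taut (φ : PropForm) : Prop := ∀ v, φ.eval v = true

/-- Modal formulas. -/
inductive ModalForm : Type
  | var : ℕ → ModalForm
  | fls : ModalForm
  | and : ModalForm → ModalForm → ModalForm
  | or : ModalForm → ModalForm → ModalForm
  | imp : ModalForm → ModalForm → ModalForm
  | box : ModalForm → ModalForm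
  deriving DecidableEq

/-- Substitution of modal formulas for the variables of a propositional formula. -/
def PropForm.subst (σ : ℕ → ModalForm) : PropForm → ModalForm
  | .var i => σ i
  | .fls => .fls
  | .and φ ψ => .and (φ.subst σ) (ψ.subst σ)
  | .or φ ψ => .or (φ.subst σ) (ψ.subst σ)
  | .imp φ ψ => .imp (φ.subst σ) (ψ.subst σ)

/-- ¬φ abbreviates φ → ⊥. -/
def ModalForm.neg (φ : ModalForm) : ModalForm := .imp φ .fls

/-- □^k φ : k-fold application of □. -/
def ModalForm.boxIter : ℕ → ModalForm → ModalForm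
  | 0, φ => φ
  | k + 1, φ => .box (ModalForm.boxIter k φ)

/-- ¬^j φ : j-fold application of ¬. -/
def ModalForm.negIter : ℕ → ModalForm → ModalForm
  | 0, φ => φ
  | k + 1, φ => (ModalForm.negIter k φ).neg

/-- φ ↔ ψ abbreviates (φ → ψ) ∧ (ψ → φ). -/
def ModalForm.iff (φ ψ : ModalForm) : ModalForm := .and (.imp φ ψ) (.imp ψ φ)

/-- Signed variables: `Vsgn φ true` is V⁺(φ), `Vsgn φ false` is V⁻(φ). -/
def ModalForm.Vsgn : ModalForm → Bool → Finset ℕ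
  | .var i, true => {i}
  | .var _, false => ∅
  | .fls, _ => ∅
  | .and φ ψ, b => φ.Vsgn b ∪ ψ.Vsgn b
  | .or φ ψ, b => φ.Vsgn b ∪ ψ.Vsgn b
  | .imp φ ψ, b => φ.Vsgn (!b) ∪ ψ.Vsgn b
  | .box φ, b => φ.Vsgn b

/-- Positive variables V⁺(φ). -/
def ModalForm.Vpos (φ : ModalForm) : Finset ℕ := φ.Vsgn true

/-- Negative variables V⁻(φ). -/
def ModalForm.Vneg (φ : ModalForm) : Finset ℕ := φ.Vsgn false

/-- All variables V(φ). -/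
def ModalForm.V (φ : ModalForm) : Finset ℕ := φ.Vpos ∪ φ.Vneg

/-- The logic NRAmn = NAmn + (Ros : from ¬φ infer ¬□φ). -/
inductive NRA (m n : ℕ) : ModalForm → Prop
  | taut (p : PropForm) (σ : ℕ → ModalForm) : p.Taut → NRA m n (p.subst σ)
  | amn (φ : ModalForm) : NRA m n (.imp (ModalForm.boxIter n φ) (ModalForm.boxIter m φ))
  | mp (φ ψ : ModalForm) : NRA m n (.imp φ ψ) → NRA m n φ → NRA m n ψ
  | nec (φ : ModalForm) : NRA m n φ → NRA m n (.box φ)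
  | ros (φ : ModalForm) : NRA m n (ModalForm.neg φ) → NRA m n (ModalForm.neg (.box φ))

namespace ModalForm

/-- The underlying relation turns every connective other than `□` into its Boolean meaning. -/
structure IsBoolean (v : ModalForm → Prop) : Prop where
  fls : ¬ v .fls
  and : ∀ A B, v (.and A B) ↔ v A ∧ v B
  or : ∀ A B, v (.or A B) ↔ v A ∨ v B
  imp : ∀ A B, v (.imp A B) ↔ (v A → v B)

theorem IsBoolean.neg {v : ModalForm → Prop} (hv : IsBoolean v) (A : ModalForm) :
    v A.neg ↔ ¬ v A := by
  simp [ModalForm.neg, hv.imp, hv.fls]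

open Classical in
theorem IsBoolean.subst_iff {v : ModalForm → Prop} (hv : IsBoolean v) (σ : ℕ → ModalForm)
    (p : PropForm) : v (p.subst σ) ↔ p.eval (fun i => decide (v (σ i))) = true := by
  induction p with
  | var i => simp [PropForm.subst, PropForm.eval]
  | fls => simp [PropForm.subst, PropForm.eval, hv.fls]
  | and A B ihA ihB => simp [PropForm.subst, PropForm.eval, hv.and, ihA, ihB]
  | or A B ihA ihB => simp [PropForm.subst, PropForm.eval, hv.or, ihA, ihB]
  | imp A B ihA ihB =>
    simp only [PropForm.subst, PropForm.eval, hv.imp, ihA, ihB]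
    cases PropForm.eval (fun i => decide (v (σ i))) A <;> simp

/-- A Gödel numbering of modal formulas. -/
def code : ModalForm → ℕ
  | .var i => Nat.pair 0 i
  | .fls => Nat.pair 1 0
  | .and A B => Nat.pair 2 (Nat.pair A.code B.code)
  | .or A B => Nat.pair 3 (Nat.pair A.code B.code)
  | .imp A B => Nat.pair 4 (Nat.pair A.code B.code)
  | .box A => Nat.pair 5 A.code

theorem code_injective : Function.Injective code := by
  intro A
  induction A with
  | var i => intro B h; cases B <;> simp [code, Nat.pair_eq_pair] at h ⊢; try exact h
  | fls => intro B h; cases B <;> simp [code, Nat.pair_eq_pair] at h ⊢; try exact h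
  | box A ih =>
    intro B h
    cases B <;> simp [code, Nat.pair_eq_pair] at h ⊢
    exact ih h
  | and A₁ A₂ ih₁ ih₂ =>
    intro B h
    cases B <;> simp [code, Nat.pair_eq_pair] at h ⊢
    exact ⟨ih₁ h.1, ih₂ h.2⟩
  | or A₁ A₂ ih₁ ih₂ =>
    intro B h
    cases B <;> simp [code, Nat.pair_eq_pair] at h ⊢
    exact ⟨ih₁ h.1, ih₂ h.2⟩
  | imp A₁ A₂ ih₁ ih₂ =>
    intro B h
    cases B <;> simp [code, Nat.pair_eq_pair] at h ⊢
    exact ⟨ih₁ h.1, ih₂ h.2⟩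

/-- The propositional skeleton of a modal formula: variables and boxed formulas become atoms. -/
def skeleton : ModalForm → PropForm
  | .var i => .var (code (.var i))
  | .fls => .fls
  | .and A B => .and A.skeleton B.skeleton
  | .or A B => .or A.skeleton B.skeleton
  | .imp A B => .imp A.skeleton B.skeleton
  | .box A => .var (code (.box A))

/-- The inverse of the Gödel numbering. -/
noncomputable def decode : ℕ → ModalForm :=
  haveI : Nonempty ModalForm := ⟨.fls⟩
  Function.invFun code

theorem decode_code (A : ModalForm) : decode A.code = A :=
  haveI : Nonempty ModalForm := ⟨.fls⟩
  Function.leftInverse_invFun code_injective A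

theorem skeleton_subst_decode (A : ModalForm) : A.skeleton.subst decode = A := by
  induction A <;> simp_all [skeleton, PropForm.subst, decode_code]

theorem isBoolean_eval_skeleton (e : ℕ → Bool) :
    IsBoolean fun A => A.skeleton.eval e = true := by
  refine ⟨?_, ?_, ?_, ?_⟩ <;> simp [skeleton, PropForm.eval]
  intro A B
  cases PropForm.eval e A.skeleton <;> simp

theorem Vsgn_neg (A : ModalForm) (s : Bool) : A.neg.Vsgn s = A.Vsgn (!s) := by
  simp [neg, Vsgn]

theorem Vsgn_boxIter (k : ℕ) (A : ModalForm) (s : Bool) :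
    (boxIter k A).Vsgn s = A.Vsgn s := by
  induction k with
  | zero => rfl
  | succ k ih => simpa [boxIter, Vsgn] using ih

/-- The formulas whose signed variables lie in `a`. -/
def Within (a : Bool → Finset ℕ) (A : ModalForm) : Prop := ∀ s, A.Vsgn s ⊆ a s

section Within
variable {a : Bool → Finset ℕ} {A B : ModalForm}

theorem within_and : Within a (.and A B) ↔ Within a A ∧ Within a B := by
  simp [Within, Vsgn, Finset.union_subset_iff, forall_and]

theorem within_or : Within a (.or A B) ↔ Within a A ∧ Within a B := by
  simp [Within, Vsgn, Finset.union_subset_iff, forall_and]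

theorem within_neg : Within a A.neg ↔ Within (fun s => a !s) A := by
  simp only [Within, Vsgn_neg, Bool.forall_bool, Bool.not_true, Bool.not_false]
  exact and_comm

theorem within_imp : Within a (.imp A B) ↔ Within a A.neg ∧ Within a B := by
  simp only [Within, Vsgn_neg]
  simp [Vsgn, Finset.union_subset_iff]
  tauto

theorem within_fls : Within a .fls := by simp [Within, Vsgn]

theorem within_neg_neg : Within a A.neg.neg ↔ Within a A := by
  simp [within_neg]

theorem Within.congr (h : Within a A) (hAB : A.Vsgn = B.Vsgn) : Within a B := by
  intro s
  rw [← hAB]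
  exact h s

theorem within_boxIter (k : ℕ) : Within a (boxIter k A) ↔ Within a A := by
  simp [Within, Vsgn_boxIter]

end Within

end ModalForm

open ModalForm

theorem NRA.of_isBoolean {m n : ℕ} {A : ModalForm} (h : ∀ v, IsBoolean v → v A) : NRA m n A := by
  rw [← skeleton_subst_decode A]
  exact .taut _ _ fun e => h _ (isBoolean_eval_skeleton e)

/-- Soundness for families of Boolean valuations closed under the axioms and rules for `□`. -/
theorem NRA.sound {m n : ℕ} {ι : Type*} {v : ι → ModalForm → Prop}
    (hv : ∀ i, IsBoolean (v i))
    (hA : ∀ i A, v i (boxIter n A) → v i (boxIter m A))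
    (hN : ∀ A, NRA m n A → (∀ i, v i A) → ∀ i, v i (.box A))
    (hR : ∀ A, NRA m n A.neg → (∀ i, ¬ v i A) → ∀ i, ¬ v i (.box A))
    {A : ModalForm} (h : NRA m n A) : ∀ i, v i A := by
  induction h with
  | taut p σ hp => exact fun i => ((hv i).subst_iff σ p).2 (hp _)
  | amn A => exact fun i => ((hv i).imp _ _).2 (hA i A)
  | mp A B _ _ ih₁ ih₂ => exact fun i => ((hv i).imp _ _).1 (ih₁ i) (ih₂ i)
  | nec A h ih => exact hN A h ih
  | ros A h ih =>
    exact fun i => ((hv i).neg _).2 (hR A h (fun j => ((hv j).neg _).1 (ih j)) i)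

/-- Derivability from a set of hypotheses, with modus ponens as the only rule. -/
inductive Ded (m n : ℕ) (L : Set ModalForm) : ModalForm → Prop
  | thm (A : ModalForm) : NRA m n A → Ded m n L A
  | hyp (A : ModalForm) : A ∈ L → Ded m n L A
  | mp (A B : ModalForm) : Ded m n L (.imp A B) → Ded m n L A → Ded m n L B

namespace Ded
variable {m n : ℕ} {L L' : Set ModalForm} {A B C : ModalForm}

theorem mono (h : L ⊆ L') (hA : Ded m n L A) : Ded m n L' A := by
  induction hA with
  | thm A h => exact .thm _ h
  | hyp A hA => exact .hyp _ (h hA)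
  | mp A B _ _ ih₁ ih₂ => exact .mp _ _ ih₁ ih₂

theorem of_isBoolean (h : ∀ v, IsBoolean v → v A) : Ded m n L A :=
  .thm _ (.of_isBoolean h)

theorem cons₁ (hA : Ded m n L A) (h : ∀ v, IsBoolean v → v A → v C) : Ded m n L C :=
  .mp A _ (of_isBoolean fun v hv => (hv.imp _ _).2 (h v hv)) hA

theorem cons₂ (hA : Ded m n L A) (hB : Ded m n L B)
    (h : ∀ v, IsBoolean v → v A → v B → v C) : Ded m n L C := by
  refine .mp B _ (cons₁ hA ?_) hB
  intro v hv hA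
  exact (hv.imp _ _).2 (h v hv hA)

theorem cons₃ {D : ModalForm} (hA : Ded m n L A) (hB : Ded m n L B) (hD : Ded m n L D)
    (h : ∀ v, IsBoolean v → v A → v B → v D → v C) : Ded m n L C := by
  refine .mp D _ (cons₂ hA hB ?_) hD
  intro v hv hA hB
  exact (hv.imp _ _).2 (h v hv hA hB)

theorem imp_of_insert (h : Ded m n (insert A L) B) : Ded m n L (.imp A B) := by
  induction h with
  | thm B h => exact cons₁ (.thm _ h) fun v hv h => (hv.imp _ _).2 fun _ => h
  | hyp B h =>
    rcases h with rfl | h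
    · exact of_isBoolean fun v hv => (hv.imp _ _).2 id
    · exact cons₁ (.hyp _ h) fun v hv h => (hv.imp _ _).2 fun _ => h
  | mp B C _ _ ih₁ ih₂ =>
    refine cons₂ ih₁ ih₂ fun v hv => ?_
    simp only [hv.imp]
    tauto

theorem nra (h : Ded m n ∅ A) : NRA m n A := by
  induction h with
  | thm A h => exact h
  | hyp A h => exact h.elim
  | mp A B _ _ ih₁ ih₂ => exact .mp _ _ ih₁ ih₂

theorem nra_imp (h : Ded m n {A} B) : NRA m n (.imp A B) :=
  nra (imp_of_insert (by simpa using h))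

theorem exists_of_sUnion {c : Set (Set ModalForm)} (hc : IsChain (· ⊆ ·) c) (hne : c.Nonempty)
    (h : Ded m n (⋃₀ c) A) : ∃ L ∈ c, Ded m n L A := by
  induction h with
  | thm A h =>
    obtain ⟨L, hL⟩ := hne
    exact ⟨L, hL, .thm _ h⟩
  | hyp A h =>
    obtain ⟨L, hL, hA⟩ := h
    exact ⟨L, hL, .hyp _ hA⟩
  | mp A B _ _ ih₁ ih₂ =>
    obtain ⟨L₁, hL₁, h₁⟩ := ih₁
    obtain ⟨L₂, hL₂, h₂⟩ := ih₂
    rcases hc.total hL₁ hL₂ with h | h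
    · exact ⟨L₂, hL₂, .mp _ _ (h₁.mono h) h₂⟩
    · exact ⟨L₁, hL₁, .mp _ _ h₁ (h₂.mono h)⟩

end Ded

/-- `L` and `R` are separated by a formula in the common signed vocabulary, where `a` bounds the
signed variables of `L` and `b` those of `R`. -/
def Separable (m n : ℕ) (a b : Bool → Finset ℕ) (L R : Set ModalForm) : Prop :=
  ∃ C, Within a C ∧ Within b C.neg ∧ Ded m n L C ∧ Ded m n R C.neg

/-- `L` is a maximal set of formulas within `a` that is inseparable from `R`. -/
structure MaxInseparable (m n : ℕ) (a b : Bool → Finset ℕ) (L R : Set ModalForm) : Prop where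
  within : ∀ A ∈ L, Within a A
  insep : ¬ Separable m n a b L R
  mem : ∀ A, Within a A → ¬ Separable m n a b (insert A L) R → A ∈ L

section Separable
variable {m n : ℕ} {a b : Bool → Finset ℕ} {L R R' : Set ModalForm} {A B : ModalForm}

theorem Separable.symm (h : Separable m n a b L R) : Separable m n b a R L := by
  obtain ⟨C, h₁, h₂, h₃, h₄⟩ := h
  exact ⟨C.neg, h₂, within_neg_neg.2 h₁, h₄,
    h₃.cons₁ fun v hv => by simp only [hv.neg]; tauto⟩

theorem Separable.mono_right (hR : R ⊆ R') (h : Separable m n a b L R) :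
    Separable m n a b L R' := by
  obtain ⟨C, h₁, h₂, h₃, h₄⟩ := h
  exact ⟨C, h₁, h₂, h₃, h₄.mono hR⟩

theorem exists_maxInseparable (hL : ∀ A ∈ L, Within a A) (h : ¬ Separable m n a b L R) :
    ∃ L', L ⊆ L' ∧ MaxInseparable m n a b L' R := by
  obtain ⟨L', hLL', hmax⟩ := zorn_subset_nonempty
    {X | (∀ A ∈ X, Within a A) ∧ ¬ Separable m n a b X R} (fun c hcS hc hne => by
      refine ⟨⋃₀ c, ⟨?_, ?_⟩, fun X hX => Set.subset_sUnion_of_mem hX⟩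
      · rintro A ⟨X, hX, hA⟩
        exact (hcS hX).1 A hA
      · rintro ⟨C, h₁, h₂, h₃, h₄⟩
        obtain ⟨X, hX, hXC⟩ := Ded.exists_of_sUnion hc hne h₃
        exact (hcS hX).2 ⟨C, h₁, h₂, hXC, h₄⟩) L ⟨hL, h⟩
  refine ⟨L', hLL', hmax.prop.1, hmax.prop.2, fun A hA hsep => ?_⟩
  refine hmax.le_of_ge (y := insert A L') ⟨?_, hsep⟩ (Set.subset_insert _ _)
    (Set.mem_insert _ _)
  rintro B (rfl | hB)
  · exact hA
  · exact hmax.prop.1 B hB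

namespace MaxInseparable

theorem mono_right (h : MaxInseparable m n a b L R) (hR : R ⊆ R')
    (hsep : ¬ Separable m n a b L R') : MaxInseparable m n a b L R' :=
  ⟨h.within, hsep, fun A hA hA' => h.mem A hA fun hs => hA' (hs.mono_right hR)⟩

theorem mem_or_mem (h : MaxInseparable m n a b L R) (hA : Within a A) (hB : Within a B)
    (hAB : Ded m n L (.or A B)) : A ∈ L ∨ B ∈ L := by
  by_contra! hcon
  have h₁ := mt (h.mem A hA) hcon.1
  have h₂ := mt (h.mem B hB) hcon.2
  obtain ⟨C, hCa, hCb, hLC, hRC⟩ := not_not.1 h₁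
  obtain ⟨D, hDa, hDb, hLD, hRD⟩ := not_not.1 h₂
  refine h.insep ⟨.or C D, within_or.2 ⟨hCa, hDa⟩, ?_, ?_, ?_⟩
  · rw [within_neg] at *
    exact within_or.2 ⟨hCb, hDb⟩
  · refine Ded.cons₃ hAB hLC.imp_of_insert hLD.imp_of_insert fun v hv => ?_
    simp only [hv.imp, hv.or]
    tauto
  · refine Ded.cons₂ hRC hRD fun v hv => ?_
    simp only [hv.neg, hv.or]
    tauto

theorem mem_of_ded (h : MaxInseparable m n a b L R) (hA : Within a A) (hAL : Ded m n L A) :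
    A ∈ L :=
  (or_self_iff).1 (h.mem_or_mem hA hA (hAL.cons₁ fun _ hv h => (hv.or _ _).2 (.inl h)))

theorem consistent (h : MaxInseparable m n a b L R) (hL : Ded m n L .fls) : False :=
  h.insep ⟨.fls, within_fls, within_neg.2 within_fls, hL,
    Ded.of_isBoolean fun _ hv => (hv.neg _).2 hv.fls⟩

theorem clash (h : MaxInseparable m n a b L R) (hR : ∀ A ∈ R, Within b A) (hA : A ∈ L)
    (hB : B.neg ∈ R) (hAB : NRA m n (.imp A B)) (hV : A.Vsgn = B.Vsgn) : False :=
  h.insep ⟨B, (h.within A hA).congr hV, hR _ hB, .mp _ _ (.thm _ hAB) (.hyp _ hA), .hyp _ hB⟩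

end MaxInseparable
end Separable

/-- The closure properties of a set of formulas from which a valuation making all of its members
true can be built. -/
structure Hintikka (m n : ℕ) (T : Set ModalForm) : Prop where
  and : ∀ A B, .and A B ∈ T → A ∈ T ∧ B ∈ T
  or : ∀ A B, .or A B ∈ T → A ∈ T ∨ B ∈ T
  imp : ∀ A B, .imp A B ∈ T → A.neg ∈ T ∨ B ∈ T
  neg_and : ∀ A B, (ModalForm.and A B).neg ∈ T → A.neg ∈ T ∨ B.neg ∈ T
  neg_or : ∀ A B, (ModalForm.or A B).neg ∈ T → A.neg ∈ T ∧ B.neg ∈ T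
  neg_imp : ∀ A B, (ModalForm.imp A B).neg ∈ T → A ∈ T ∧ B.neg ∈ T
  boxIter : ∀ A, m = 0 → ModalForm.boxIter n A ∈ T → A ∈ T
  neg_boxIter : ∀ A, n = 0 → (ModalForm.boxIter m A).neg ∈ T → A.neg ∈ T
  clash : ∀ A B, A ∈ T → B.neg ∈ T → NRA m n (.imp A B) → A.Vsgn = B.Vsgn → False
  consistent : ∀ A, A ∈ T → ¬ NRA m n A.neg

theorem MaxInseparable.hintikka {m n : ℕ} {a b : Bool → Finset ℕ} {L R : Set ModalForm}
    (hL : MaxInseparable m n a b L R) (hR : MaxInseparable m n b a R L) :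
    Hintikka m n (L ∪ R) := by
  have key : ∀ {a b : Bool → Finset ℕ} {L R : Set ModalForm},
      MaxInseparable m n a b L R →
      (∀ A B, .and A B ∈ L → A ∈ L ∧ B ∈ L) ∧
      (∀ A B, .or A B ∈ L → A ∈ L ∨ B ∈ L) ∧
      (∀ A B, .imp A B ∈ L → A.neg ∈ L ∨ B ∈ L) ∧
      (∀ A B, (ModalForm.and A B).neg ∈ L → A.neg ∈ L ∨ B.neg ∈ L) ∧
      (∀ A B, (ModalForm.or A B).neg ∈ L → A.neg ∈ L ∧ B.neg ∈ L) ∧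
      (∀ A B, (ModalForm.imp A B).neg ∈ L → A ∈ L ∧ B.neg ∈ L) ∧
      (∀ A, m = 0 → ModalForm.boxIter n A ∈ L → A ∈ L) ∧
      (∀ A, n = 0 → (ModalForm.boxIter m A).neg ∈ L → A.neg ∈ L) ∧
      (∀ A B, A ∈ L → B.neg ∈ L → NRA m n (.imp A B) → False) ∧
      (∀ A, A ∈ L → ¬ NRA m n A.neg) := by
    clear hL hR a b L R
    intro a b L R h
    refine ⟨?_, ?_, ?_, ?_, ?_, ?_, ?_, ?_, ?_, ?_⟩
    · intro A B hAB
      have hw := within_and.1 (h.within _ hAB)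
      exact ⟨h.mem_of_ded hw.1 ((Ded.hyp _ hAB).cons₁ fun v hv => by rw [hv.and]; tauto),
        h.mem_of_ded hw.2 ((Ded.hyp _ hAB).cons₁ fun v hv => by rw [hv.and]; tauto)⟩
    · intro A B hAB
      have hw := within_or.1 (h.within _ hAB)
      exact h.mem_or_mem hw.1 hw.2 (.hyp _ hAB)
    · intro A B hAB
      have hw := within_imp.1 (h.within _ hAB)
      exact h.mem_or_mem hw.1 hw.2 ((Ded.hyp _ hAB).cons₁ fun v hv => by
        simp only [hv.imp, hv.or, hv.neg]; tauto)
    · intro A B hAB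
      have hw := within_and.1 (within_neg.1 (h.within _ hAB))
      exact h.mem_or_mem (within_neg.2 hw.1) (within_neg.2 hw.2)
        ((Ded.hyp _ hAB).cons₁ fun v hv => by simp only [hv.and, hv.or, hv.neg]; tauto)
    · intro A B hAB
      have hw := within_or.1 (within_neg.1 (h.within _ hAB))
      exact ⟨h.mem_of_ded (within_neg.2 hw.1)
          ((Ded.hyp _ hAB).cons₁ fun v hv => by simp only [hv.or, hv.neg]; tauto),
        h.mem_of_ded (within_neg.2 hw.2)
          ((Ded.hyp _ hAB).cons₁ fun v hv => by simp only [hv.or, hv.neg]; tauto)⟩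
    · intro A B hAB
      have hw := within_imp.1 (within_neg.1 (h.within _ hAB))
      exact ⟨h.mem_of_ded (within_neg_neg.1 (within_neg.2 hw.1))
          ((Ded.hyp _ hAB).cons₁ fun v hv => by simp only [hv.imp, hv.neg]; tauto),
        h.mem_of_ded (within_neg.2 hw.2)
          ((Ded.hyp _ hAB).cons₁ fun v hv => by simp only [hv.imp, hv.neg]; tauto)⟩
    · rintro A rfl hA
      exact h.mem_of_ded ((within_boxIter n).1 (h.within _ hA))
        (.mp _ _ (.thm _ (.amn A)) (.hyp _ hA))
    · rintro A rfl hA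
      refine h.mem_of_ded (within_neg.2 ((within_boxIter m).1 (within_neg.1 (h.within _ hA)))) ?_
      refine Ded.cons₂ (.thm _ (.amn A)) (.hyp _ hA) fun v hv => ?_
      simp only [hv.imp, hv.neg, ModalForm.boxIter]
      tauto
    · intro A B hA hB hAB
      refine h.consistent (Ded.cons₃ (.thm _ hAB) (.hyp _ hA) (.hyp _ hB) fun v hv => ?_)
      simp only [hv.imp, hv.neg]
      tauto
    · intro A hA hnA
      refine h.consistent (Ded.cons₂ (.thm _ hnA) (.hyp _ hA) fun v hv => ?_)
      simp only [hv.neg]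
      tauto
  obtain ⟨l1, l2, l3, l4, l5, l6, l7, l8, l9, l10⟩ := key hL
  obtain ⟨r1, r2, r3, r4, r5, r6, r7, r8, r9, r10⟩ := key hR
  refine ⟨?_, ?_, ?_, ?_, ?_, ?_, ?_, ?_, ?_, ?_⟩
  · rintro A B (h | h)
    · exact (l1 A B h).imp .inl .inl
    · exact (r1 A B h).imp .inr .inr
  · rintro A B (h | h)
    · exact (l2 A B h).imp .inl .inl
    · exact (r2 A B h).imp .inr .inr
  · rintro A B (h | h)
    · exact (l3 A B h).imp .inl .inl
    · exact (r3 A B h).imp .inr .inr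
  · rintro A B (h | h)
    · exact (l4 A B h).imp .inl .inl
    · exact (r4 A B h).imp .inr .inr
  · rintro A B (h | h)
    · exact (l5 A B h).imp .inl .inl
    · exact (r5 A B h).imp .inr .inr
  · rintro A B (h | h)
    · exact (l6 A B h).imp .inl .inl
    · exact (r6 A B h).imp .inr .inr
  · rintro A hm (h | h)
    · exact .inl (l7 A hm h)
    · exact .inr (r7 A hm h)
  · rintro A hm (h | h)
    · exact .inl (l8 A hm h)
    · exact .inr (r8 A hm h)
  · rintro A B (hA | hA) (hB | hB) hAB hV
    · exact l9 A B hA hB hAB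
    · exact hL.clash hR.within hA hB hAB hV
    · exact hR.clash hL.within hA hB hAB hV
    · exact r9 A B hA hB hAB
  · rintro A (h | h)
    · exact l10 A h
    · exact r10 A h

/-- The Boolean valuation with `p` true iff `p ∈ T` and `□A` true iff `f A`. -/
def flatTruth (T : Set ModalForm) (f : ModalForm → Prop) : ModalForm → Prop
  | .var i => .var i ∈ T
  | .fls => False
  | .and A B => flatTruth T f A ∧ flatTruth T f B
  | .or A B => flatTruth T f A ∨ flatTruth T f B
  | .imp A B => flatTruth T f A → flatTruth T f B
  | .box A => f A

/-- Truth in a chain of worlds. World `i + 1` sees itself and world `i`; the results of looking at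
both are combined by `op`. World `0` respects `T` on boxed formulas and otherwise sees world `k`. -/
def chainTruth (T : Set ModalForm) (op : Prop → Prop → Prop) (k : ℕ) : ModalForm → ℕ → Prop
  | .var i, _ => .var i ∈ T
  | .fls, _ => False
  | .and A B, i => chainTruth T op k A i ∧ chainTruth T op k B i
  | .or A B, i => chainTruth T op k A i ∨ chainTruth T op k B i
  | .imp A B, i => chainTruth T op k A i → chainTruth T op k B i
  | .box A, 0 => .box A ∈ T ∨ (A.box.neg ∉ T ∧ chainTruth T op k A k)
  | .box A, i + 1 => op (chainTruth T op k A (i + 1)) (chainTruth T op k A i)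

theorem isBoolean_flatTruth (T : Set ModalForm) (f : ModalForm → Prop) :
    IsBoolean (flatTruth T f) := by
  constructor <;> simp [flatTruth]

theorem isBoolean_chainTruth (T : Set ModalForm) (op : Prop → Prop → Prop) (k i : ℕ) :
    IsBoolean fun A => chainTruth T op k A i := by
  constructor <;> simp [chainTruth]

namespace Hintikka
variable {m n : ℕ} {T : Set ModalForm}

theorem not_both (hT : Hintikka m n T) {A : ModalForm} (h : A ∈ T) (h' : A.neg ∈ T) : False :=
  hT.clash A A h h' (.of_isBoolean fun _ hv => (hv.imp _ _).2 id) rfl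

theorem not_neg_mem (hT : Hintikka m n T) {A : ModalForm} (h : NRA m n A) : A.neg ∉ T :=
  fun hA => hT.consistent _ hA <| .mp _ _
    (.of_isBoolean fun v hv => by simp only [hv.imp, hv.neg]; tauto) h

theorem truth (hT : Hintikka m n T) {v : ModalForm → Prop} (hv : IsBoolean v)
    (hvar : ∀ i, v (.var i) ↔ .var i ∈ T)
    (hbox : ∀ A, .box A ∈ T → v (.box A)) (hnbox : ∀ A, (ModalForm.box A).neg ∈ T → ¬ v (.box A))
    (A : ModalForm) : (A ∈ T → v A) ∧ (A.neg ∈ T → ¬ v A) := by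
  induction A with
  | var i => exact ⟨(hvar i).2, fun h h' => hT.not_both ((hvar i).1 h') h⟩
  | fls =>
    exact ⟨fun h => (hT.consistent _ h (.of_isBoolean fun _ hv => (hv.neg _).2 hv.fls)).elim,
      fun _ => hv.fls⟩
  | and A B ihA ihB =>
    have h₁ := hT.and A B
    have h₂ := hT.neg_and A B
    rw [hv.and]
    tauto
  | or A B ihA ihB =>
    have h₁ := hT.or A B
    have h₂ := hT.neg_or A B
    rw [hv.or]
    tauto
  | imp A B ihA ihB =>
    have h₁ := hT.imp A B
    have h₂ := hT.neg_imp A B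
    rw [hv.imp]
    tauto
  | box A _ => exact ⟨hbox A, hnbox A⟩

theorem truth_chain (hT : Hintikka m n T) (op : Prop → Prop → Prop) (k : ℕ) (A : ModalForm) :
    (A ∈ T → chainTruth T op k A 0) ∧ (A.neg ∈ T → ¬ chainTruth T op k A 0) := by
  refine hT.truth (isBoolean_chainTruth T op k 0) (fun i => Iff.rfl) (fun A h => .inl h) ?_ A
  rintro A hA (h | h)
  · exact hT.not_both h hA
  · exact h.1 hA

/-- Soundness of the chain model, given that it validates the reduction axiom. -/
theorem chain_sound (hT : Hintikka m n T) {op : Prop → Prop → Prop} {k : ℕ}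
    (hop : op True True) (hop' : ¬ op False False)
    (hA : ∀ i A, chainTruth T op k (ModalForm.boxIter n A) i →
      chainTruth T op k (ModalForm.boxIter m A) i)
    {A : ModalForm} (h : NRA m n A) : chainTruth T op k A 0 := by
  refine NRA.sound (v := fun i A => chainTruth T op k A i)
    (isBoolean_chainTruth T op k) hA ?_ ?_ h 0
  · rintro A h hA (_ | i)
    · exact .inr ⟨hT.not_neg_mem (.nec _ h), hA k⟩
    · simpa [chainTruth, hA] using hop
  · rintro A h hA (_ | i)
    · rintro (hm | hm)
      · exact hT.consistent _ hm (.ros _ h)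
      · exact hA k hm.2
    · simpa [chainTruth, hA] using hop'

theorem exists_valuation_of_reflection (hT : Hintikka 0 (n + 1) T) :
    ∃ v, IsBoolean v ∧ (∀ A, NRA 0 (n + 1) A → v A) ∧
      ∀ A, (A ∈ T → v A) ∧ (A.neg ∈ T → ¬ v A) := by
  refine ⟨_, isBoolean_chainTruth T And n 0,
    fun A => hT.chain_sound (by simp) (by simp) ?_, hT.truth_chain And n⟩
  rintro (_ | i) A h
  · change ModalForm.box _ ∈ T ∨ _ at h
    rcases h with h | ⟨-, h⟩
    · exact (hT.truth_chain And n A).1 (hT.boxIter A rfl h)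
    · have key : ∀ j, chainTruth T And n (ModalForm.boxIter j A) j → chainTruth T And n A 0 := by
        intro j
        induction j with
        | zero => exact id
        | succ j ih => exact fun h => ih h.2
      exact key n h
  · have key : ∀ j, chainTruth T And n (ModalForm.boxIter j A) (i + 1) →
        chainTruth T And n A (i + 1) := by
      intro j
      induction j with
      | zero => exact id
      | succ j ih => exact fun h => ih h.1
    exact key _ h

theorem exists_valuation_of_coreflection (hT : Hintikka (m + 1) 0 T) :
    ∃ v, IsBoolean v ∧ (∀ A, NRA (m + 1) 0 A → v A) ∧
      ∀ A, (A ∈ T → v A) ∧ (A.neg ∈ T → ¬ v A) := by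
  refine ⟨_, isBoolean_chainTruth T Or m 0,
    fun A => hT.chain_sound (by simp) (by simp) ?_, hT.truth_chain Or m⟩
  rintro (_ | i) A h
  · refine .inr ⟨fun hm => (hT.truth_chain Or m A).2 (hT.neg_boxIter A rfl hm) h, ?_⟩
    have key : ∀ j, chainTruth T Or m (ModalForm.boxIter j A) j := by
      intro j
      induction j with
      | zero => exact h
      | succ j ih => exact .inr ih
    exact key m
  · have key : ∀ j, chainTruth T Or m (ModalForm.boxIter j A) (i + 1) := by
      intro j
      induction j with
      | zero => exact h
      | succ j ih => exact .inl ih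
    exact key _

theorem exists_valuation_of_iff (hT : Hintikka m n T) (hne : T.Nonempty) (hmn : m = 0 ↔ n = 0) :
    ∃ v, IsBoolean v ∧ (∀ A, NRA m n A → v A) ∧
      ∀ A, (A ∈ T → v A) ∧ (A.neg ∈ T → ¬ v A) := by
  have hcases : (m = 0 ∧ n = 0) ∨ ∃ m' n', m = m' + 1 ∧ n = n' + 1 := by
    rcases m with _ | m <;> rcases n with _ | n <;> simp_all
  let f : ModalForm → Prop := fun A => NRA m n (.box A) ∨
    ∃ B ∈ T, NRA m n (.imp B (.box A)) ∧ B.Vsgn = (ModalForm.box A).Vsgn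
  have hb := isBoolean_flatTruth T f
  refine ⟨flatTruth T f, hb, fun A h => ?_, hT.truth hb (fun i => Iff.rfl) ?_ ?_⟩
  · refine NRA.sound (v := fun _ : Unit => flatTruth T f) (fun _ => hb) ?_ ?_ ?_ h ()
    · intro _ A hA
      rcases hcases with ⟨rfl, rfl⟩ | ⟨m, n, rfl, rfl⟩
      · exact hA
      · rcases hA with h | ⟨B, hB, h, hV⟩
        · exact .inl (.mp _ _ (.amn A) h)
        · refine .inr ⟨B, hB, ?_, ?_⟩
          · refine Ded.nra (Ded.cons₂ (.thm _ h) (.thm _ (.amn A)) fun v hv => ?_)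
            simp only [hv.imp, ModalForm.boxIter]
            tauto
          · rw [hV]
            funext s
            exact (Vsgn_boxIter (n + 1) A s).trans (Vsgn_boxIter (m + 1) A s).symm
    · exact fun A h _ _ => .inl (.nec _ h)
    · rintro A h - - (h' | ⟨B, hB, h', -⟩)
      · obtain ⟨B, hB⟩ := hne
        refine hT.consistent B hB (Ded.nra (Ded.cons₂ (.thm _ (.ros _ h)) (.thm _ h')
          fun v hv => ?_))
        simp only [hv.neg]
        tauto
      · refine hT.consistent B hB (Ded.nra (Ded.cons₂ (.thm _ (.ros _ h)) (.thm _ h')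
          fun v hv => ?_))
        simp only [hv.neg, hv.imp]
        tauto
  · exact fun A hA => .inr ⟨_, hA, .of_isBoolean fun v hv => (hv.imp _ _).2 id, rfl⟩
  · rintro A hA (h | ⟨B, hB, h, hV⟩)
    · exact hT.not_neg_mem h hA
    · exact hT.clash B _ hB hA h hV

theorem exists_valuation (hT : Hintikka m n T) (hne : T.Nonempty) :
    ∃ v, IsBoolean v ∧ (∀ A, NRA m n A → v A) ∧
      ∀ A, (A ∈ T → v A) ∧ (A.neg ∈ T → ¬ v A) := by
  match m, n with
  | 0, 0 => exact hT.exists_valuation_of_iff hne (by simp)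
  | 0, n + 1 => exact hT.exists_valuation_of_reflection
  | m + 1, 0 => exact hT.exists_valuation_of_coreflection
  | m + 1, n + 1 => exact hT.exists_valuation_of_iff hne (by simp)

end Hintikka

/-- NRA enjoys the Lyndon interpolation property. -/
theorem NRA_LIP (m n : ℕ) (φ ψ : ModalForm) (h : NRA m n (.imp φ ψ)) :
    ∃ χ : ModalForm,
      χ.Vpos ⊆ φ.Vpos ∩ ψ.Vpos ∧ χ.Vneg ⊆ φ.Vneg ∩ ψ.Vneg ∧
      NRA m n (.imp φ χ) ∧ NRA m n (.imp χ ψ) := by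
  by_cases hsep : Separable m n φ.Vsgn ψ.neg.Vsgn {φ} {ψ.neg}
  · obtain ⟨χ, hφ, hψ, hφχ, hψχ⟩ := hsep
    have hψ' : ∀ s, χ.Vsgn s ⊆ ψ.Vsgn s := fun s => by
      simpa [Vsgn_neg] using hψ (!s)
    refine ⟨χ, Finset.subset_inter (hφ _) (hψ' _), Finset.subset_inter (hφ _) (hψ' _),
      hφχ.nra_imp, ?_⟩
    refine Ded.nra (Ded.cons₁ (.thm _ hψχ.nra_imp) fun v hv => ?_)
    simp only [hv.imp, hv.neg]
    tauto
  · obtain ⟨L, hφL, hL⟩ := exists_maxInseparable (by simp [Within]) hsep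
    obtain ⟨R, hψR, hR⟩ := exists_maxInseparable (L := {ψ.neg}) (R := L) (by simp [Within])
      (mt Separable.symm hL.insep)
    have hT := (hL.mono_right hψR (mt Separable.symm hR.insep)).hintikka hR
    have hφ : φ ∈ L ∪ R := .inl (hφL rfl)
    obtain ⟨v, hv, hthm, htruth⟩ := hT.exists_valuation ⟨φ, hφ⟩
    exact absurd ((hv.imp _ _).1 (hthm _ h) ((htruth φ).1 hφ)) ((htruth ψ).2 (.inr (hψR rfl)))
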